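/- arXiv:0805.4739 — 3 statements merged into one kernel-verified Lean document; each statement's English description precedes it below -/
import Mathlib

section
/- There exists a topology on [0,1]×[0,1] for which the prescribed families are neighborhood bases: for each point (x,0) the sets U(x,0,n) = (((x−2^{−n}, x+2^{−n}) ∩ [0,1]) × [0,1]) \ ({x} × [2^{−n},1]), n ∈ ℕ, form a local base at (x,0), and for each point (x,y) with y > 0 the sets U(x,y,n) = {x} × ((y−2^{−n}, y+2^{−n}) ∩ [0,1]), n ∈ ℕ, form a local base at (x,y). -/
open Set Filter Topology TopologicalSpace

noncomputable section

/-- The underlying set of the connected comb `C`: the unit square `[0,1] × [0,1]`. -/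
def Comb : Type := unitInterval × unitInterval

namespace Comb

/-- `mk x y` is the point `(x, y)` of the comb. -/
def mk (x y : unitInterval) : Comb := (x, y)

/-- The prescribed basic neighbourhoods `U(x,y,n)`:
for `y = 0` it is `(((x − 2⁻ⁿ, x + 2⁻ⁿ) ∩ [0,1]) × [0,1]) \ ({x} × [2⁻ⁿ, 1])`
(the intersections with `[0,1]` are automatic since coordinates are in `unitInterval`),
and for `y > 0` it is `{x} × ((y − 2⁻ⁿ, y + 2⁻ⁿ) ∩ [0,1])`. -/
def U (p : Comb) (n : ℕ) : Set Comb :=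
  if (p.2 : ℝ) = 0 then
    {q : Comb | (q.1 : ℝ) ∈ Set.Ioo ((p.1 : ℝ) - 2 ^ (-(n : ℤ))) ((p.1 : ℝ) + 2 ^ (-(n : ℤ)))} \
      {q : Comb | q.1 = p.1 ∧ (q.2 : ℝ) ∈ Set.Icc ((2 : ℝ) ^ (-(n : ℤ))) 1}
  else
    {q : Comb | q.1 = p.1 ∧
      (q.2 : ℝ) ∈ Set.Ioo ((p.2 : ℝ) - 2 ^ (-(n : ℤ))) ((p.2 : ℝ) + 2 ^ (-(n : ℤ)))}

/-- The neighbourhood filter at `p` generated by the basic neighbourhoods `U p n`. -/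
def nhdsFun (p : Comb) : Filter Comb := ⨅ n : ℕ, 𝓟 (U p n)

/-- The comb topology: the topology determined by the prescribed neighbourhood bases
(a set is open iff it is a neighbourhood, in the sense of the prescribed bases,
of each of its points). -/
instance : TopologicalSpace Comb := TopologicalSpace.mkOfNhds nhdsFun

end Comb

namespace Comb

theorem exists_two_zpow_neg_lt {δ : ℝ} (hδ : 0 < δ) : ∃ n : ℕ, (2 : ℝ) ^ (-(n : ℤ)) < δ := by
  obtain ⟨n, hn⟩ := exists_pow_lt_of_lt_one hδ (by norm_num : (1 / 2 : ℝ) < 1)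
  exact ⟨n, by simpa [zpow_neg] using hn⟩

theorem two_zpow_neg_pos (n : ℕ) : (0 : ℝ) < 2 ^ (-(n : ℤ)) := by positivity

theorem mem_U_of_snd_eq_zero {p q : Comb} (hp : (p.2 : ℝ) = 0) (n : ℕ) :
    q ∈ U p n ↔ ((p.1 : ℝ) - 2 ^ (-(n : ℤ)) < q.1 ∧ (q.1 : ℝ) < p.1 + 2 ^ (-(n : ℤ))) ∧
      (q.1 = p.1 → (q.2 : ℝ) < 2 ^ (-(n : ℤ))) := by
  have h1 : (q.2 : ℝ) ≤ 1 := q.2.2.2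
  simp only [U, if_pos hp, Set.mem_sdiff, mem_ofPred_eq, mem_Ioo, mem_Icc, h1, and_true, not_and,
    not_le]

theorem mem_U_of_snd_ne_zero {p q : Comb} (hp : (p.2 : ℝ) ≠ 0) (n : ℕ) :
    q ∈ U p n ↔ q.1 = p.1 ∧
      (p.2 : ℝ) - 2 ^ (-(n : ℤ)) < q.2 ∧ (q.2 : ℝ) < p.2 + 2 ^ (-(n : ℤ)) := by
  simp only [U, if_neg hp, mem_ofPred_eq, mem_Ioo]

theorem self_mem_U (p : Comb) (n : ℕ) : p ∈ U p n := by
  have h := two_zpow_neg_pos n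
  by_cases hp : (p.2 : ℝ) = 0
  · rw [mem_U_of_snd_eq_zero hp]
    exact ⟨⟨by linarith, by linarith⟩, fun _ => by linarith⟩
  · rw [mem_U_of_snd_ne_zero hp]
    exact ⟨rfl, by linarith, by linarith⟩

theorem U_antitone (p : Comb) : Antitone (U p) := by
  intro m n hmn q hq
  have h : (2 : ℝ) ^ (-(n : ℤ)) ≤ 2 ^ (-(m : ℤ)) :=
    zpow_le_zpow_right₀ one_le_two (by omega)
  by_cases hp : (p.2 : ℝ) = 0
  · rw [mem_U_of_snd_eq_zero hp] at hq ⊢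
    exact ⟨⟨by linarith [hq.1.1], by linarith [hq.1.2]⟩, fun e => (hq.2 e).trans_le h⟩
  · rw [mem_U_of_snd_ne_zero hp] at hq ⊢
    exact ⟨hq.1, by linarith [hq.2.1], by linarith [hq.2.2]⟩

theorem hasBasis_nhdsFun (p : Comb) : (nhdsFun p).HasBasis (fun _ : ℕ => True) (U p) :=
  hasBasis_iInf_principal (U_antitone p).directed_ge

/-- On the base line, each `U p n` contains a basic neighbourhood of each of its points. -/
theorem exists_U_subset_of_snd_eq_zero {p q : Comb} (hp : (p.2 : ℝ) = 0) {n : ℕ}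
    (hq : q ∈ U p n) : ∃ k, U q k ⊆ U p n := by
  have hq' := (mem_U_of_snd_eq_zero hp n).1 hq
  obtain ⟨⟨h1, h2⟩, h3⟩ := hq'
  by_cases hx : q.1 = p.1
  · by_cases hy : (q.2 : ℝ) = 0
    · have : q = p := Prod.ext hx (Subtype.ext (hy.trans hp.symm))
      exact ⟨n, this ▸ subset_rfl⟩
    · obtain ⟨k, hk⟩ := exists_two_zpow_neg_lt (sub_pos.2 (h3 hx))
      refine ⟨k, fun r hr => ?_⟩
      rw [mem_U_of_snd_ne_zero hy] at hr
      rw [mem_U_of_snd_eq_zero hp, hr.1]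
      exact ⟨⟨h1, h2⟩, fun _ => by linarith [hr.2.2]⟩
  · by_cases hy : (q.2 : ℝ) = 0
    · have hd : 0 < |(q.1 : ℝ) - p.1| :=
        abs_pos.2 (sub_ne_zero.2 fun e => hx (Subtype.ext e))
      obtain ⟨k, hk⟩ := exists_two_zpow_neg_lt
        (lt_min hd (lt_min (sub_pos.2 h1) (sub_pos.2 h2)))
      rw [lt_min_iff, lt_min_iff] at hk
      refine ⟨k, fun r hr => ?_⟩
      rw [mem_U_of_snd_eq_zero hy] at hr
      rw [mem_U_of_snd_eq_zero hp]
      refine ⟨⟨by linarith [hr.1.1], by linarith [hr.1.2]⟩, fun e => ?_⟩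
      rw [e] at hr
      exact absurd hk.1 (not_lt.2 (abs_le.2 ⟨by linarith [hr.1.2], by linarith [hr.1.1]⟩))
    · refine ⟨0, fun r hr => ?_⟩
      rw [mem_U_of_snd_ne_zero hy] at hr
      rw [mem_U_of_snd_eq_zero hp, hr.1]
      exact ⟨⟨h1, h2⟩, fun e => absurd e hx⟩

/-- Off the base line, `U p n` contains a basic neighbourhood of each of its points
that lies off the base line. -/
theorem exists_U_subset_of_snd_ne_zero {p q : Comb} (hp : (p.2 : ℝ) ≠ 0)
    (hy : (q.2 : ℝ) ≠ 0) {n : ℕ} (hq : q ∈ U p n) : ∃ k, U q k ⊆ U p n := by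
  obtain ⟨hx, h1, h2⟩ := (mem_U_of_snd_ne_zero hp n).1 hq
  obtain ⟨k, hk⟩ := exists_two_zpow_neg_lt (lt_min (sub_pos.2 h1) (sub_pos.2 h2))
  rw [lt_min_iff] at hk
  refine ⟨k, fun r hr => ?_⟩
  rw [mem_U_of_snd_ne_zero hy] at hr
  rw [mem_U_of_snd_ne_zero hp]
  exact ⟨hr.1.trans hx, by linarith [hr.2.1], by linarith [hr.2.2]⟩

theorem eventually_U_mem_nhdsFun (p : Comb) (n : ℕ) :
    ∀ᶠ q in nhdsFun p, U p n ∈ nhdsFun q := by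
  have mem_of_subset {q : Comb} (h : ∃ k, U q k ⊆ U p n) : U p n ∈ nhdsFun q :=
    (hasBasis_nhdsFun q).mem_iff.2 (h.imp fun _ hk => ⟨trivial, hk⟩)
  have hU (m : ℕ) : U p m ∈ nhdsFun p := (hasBasis_nhdsFun p).mem_of_mem trivial
  by_cases hp : (p.2 : ℝ) = 0
  · filter_upwards [hU n] with q hq
    exact mem_of_subset (exists_U_subset_of_snd_eq_zero hp hq)
  · obtain ⟨m, hm⟩ := exists_two_zpow_neg_lt (lt_of_le_of_ne p.2.2.1 (Ne.symm hp))
    filter_upwards [hU n, hU m] with q hq hqm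
    rw [mem_U_of_snd_ne_zero hp] at hqm
    have hy : (0 : ℝ) < q.2 := by linarith [hqm.2.1]
    exact mem_of_subset (exists_U_subset_of_snd_ne_zero hp hy.ne' hq)

end Comb

/-- There exists a topology on the unit square for which the prescribed
families `U p n` are neighbourhood bases: every `U p n` is a neighbourhood of `p` and
every neighbourhood of `p` contains some `U p n`. -/
theorem comb_topology_exists :
    ∃ t : TopologicalSpace Comb, ∀ p : Comb,
      (@nhds Comb t p).HasBasis (fun _ : ℕ => True) (fun n => Comb.U p n) := by
  refine ⟨.mkOfNhds Comb.nhdsFun, fun p => ?_⟩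
  rw [nhds_mkOfNhds_of_hasBasis Comb.hasBasis_nhdsFun (fun p n _ => Comb.self_mem_U p n)
    (fun p n _ => Comb.eventually_U_mem_nhdsFun p n)]
  exact Comb.hasBasis_nhdsFun p
end
end

section
/- Let E ⊆ [0,1]² be symmetric. For every point p = (x,a,y,b) of C_E that does not lie in the base square S = {(u,0,v,0) : u,v ∈ [0,1]}, there is a path in C_E joining p to the point (x,0,y,0) of S. -/
open Set Filter Topology TopologicalSpace

noncomputable section

namespace Comb

/-- The cross-shaped set `D_{x,a} = ({x} × [a,1] × C) ∪ (C × {x} × [a,1]) ⊆ C × C`. -/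
def Dset (x : unitInterval) (a : ℝ) : Set (Comb × Comb) :=
  {p : Comb × Comb | p.1.1 = x ∧ (p.1.2 : ℝ) ∈ Set.Icc a 1} ∪
  {p : Comb × Comb | p.2.1 = x ∧ (p.2.2 : ℝ) ∈ Set.Icc a 1}

/-- A subset `E` of the unit square is symmetric if `(x,y) ∈ E ↔ (y,x) ∈ E` for all `x, y`. -/
def SymmSet (E : Set (unitInterval × unitInterval)) : Prop :=
  ∀ x y : unitInterval, (x, y) ∈ E ↔ (y, x) ∈ E

/-- The open set `⋃_{(x,y) ∉ E} ({x} × (0,1]) × ({y} × (0,1])` that is removed from `C × C`. -/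
def removedSet (E : Set (unitInterval × unitInterval)) : Set (Comb × Comb) :=
  ⋃ q ∈ Eᶜ, {p : Comb × Comb | p.1.1 = q.1 ∧ (p.1.2 : ℝ) ∈ Set.Ioc 0 1 ∧
    p.2.1 = q.2 ∧ (p.2.2 : ℝ) ∈ Set.Ioc 0 1}

/-- The space `C_E`: the complement in `C × C` of the removed set. -/
def CE (E : Set (unitInterval × unitInterval)) : Set (Comb × Comb) := (removedSet E)ᶜ

/-- `D^E_{x,a} = D_{x,a} ∩ C_E`. -/
def DE (E : Set (unitInterval × unitInterval)) (x : unitInterval) (a : ℝ) :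
    Set (Comb × Comb) := Dset x a ∩ CE E

/-- The base square `S = {(x,0,y,0) : x, y ∈ [0,1]}` of `C × C`. -/
def baseSquare : Set (Comb × Comb) :=
  {p : Comb × Comb | (p.1.2 : ℝ) = 0 ∧ (p.2.2 : ℝ) = 0}

end Comb

namespace Comb

theorem tendsto_mk_nhdsFun (x y : unitInterval) :
    Tendsto (mk x) (𝓝 y) (nhdsFun (mk x y)) := by
  refine tendsto_iInf.2 fun n => tendsto_principal.2 ?_
  have hpos : (0 : ℝ) < 2 ^ (-(n : ℤ)) := by positivity
  have hball : ∀ᶠ z : unitInterval in 𝓝 y,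
      (z : ℝ) ∈ Set.Ioo ((y : ℝ) - 2 ^ (-(n : ℤ))) ((y : ℝ) + 2 ^ (-(n : ℤ))) :=
    continuous_subtype_val.continuousAt.eventually
      (Ioo_mem_nhds (sub_lt_self _ hpos) (lt_add_of_pos_right _ hpos))
  filter_upwards [hball] with z hz
  by_cases hy : (y : ℝ) = 0
  · rw [U, if_pos (show ((mk x y).2 : ℝ) = 0 from hy)]
    refine ⟨⟨sub_lt_self _ hpos, lt_add_of_pos_right _ hpos⟩, fun h => ?_⟩
    have h1 : (2 : ℝ) ^ (-(n : ℤ)) ≤ z := h.2.1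
    have h2 := hz.2
    rw [hy, zero_add] at h2
    exact absurd h1 (not_le.2 h2)
  · rw [U, if_neg (show ¬((mk x y).2 : ℝ) = 0 from hy)]
    exact ⟨rfl, hz⟩

/-- Each vertical segment `{x} × [0,1]` carries its usual topology or a coarser one. -/
theorem continuous_mk (x : unitInterval) : Continuous (mk x) :=
  continuous_def.2 fun _ hs => isOpen_iff_mem_nhds.2 fun y hy =>
    tendsto_mk_nhdsFun x y (hs (mk x y) hy)

/-- `C_E` is closed under scaling both heights by a common factor. -/
theorem mk_mul_mem_CE {E : Set (unitInterval × unitInterval)} {p : Comb × Comb}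
    (hp : p ∈ CE E) (t : unitInterval) :
    (mk p.1.1 (p.1.2 * t), mk p.2.1 (p.2.2 * t)) ∈ CE E := by
  have pos_of_mul_pos (a : unitInterval) (h : 0 < ((a * t : unitInterval) : ℝ)) : 0 < (a : ℝ) :=
    h.trans_le (mul_le_of_le_one_right a.2.1 t.2.2)
  intro h
  obtain ⟨q, hq, h1, h2, h3, h4⟩ := mem_iUnion₂.1 h
  exact hp (mem_iUnion₂.2 ⟨q, hq, h1, ⟨pos_of_mul_pos _ h2.1, p.1.2.2.2⟩, h3,
    ⟨pos_of_mul_pos _ h4.1, p.2.2.2.2⟩⟩)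

end Comb

/-- Let `E ⊆ [0,1]²` be symmetric. Every point `p = (x,a,y,b)` of `C_E`
not in the base square `S = {(u,0,v,0)}` can be joined to the point `(x,0,y,0)` of `S`
by a path lying in `C_E`. -/
theorem joinedIn_CE_to_base (E : Set (unitInterval × unitInterval))
    (hE : Comb.SymmSet E) (p : Comb × Comb) (hp : p ∈ Comb.CE E)
    (hnb : p ∉ Comb.baseSquare) :
    JoinedIn (Comb.CE E) p (Comb.mk p.1.1 0, Comb.mk p.2.1 0) := by
  refine ⟨⟨⟨fun t => (Comb.mk p.1.1 (p.1.2 * unitInterval.symm t),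
    Comb.mk p.2.1 (p.2.2 * unitInterval.symm t)), ?_⟩, ?_, ?_⟩,
    fun t => Comb.mk_mul_mem_CE hp (unitInterval.symm t)⟩
  · exact ((Comb.continuous_mk _).comp (continuous_const.mul unitInterval.continuous_symm)).prodMk
      ((Comb.continuous_mk _).comp (continuous_const.mul unitInterval.continuous_symm))
  · simp only [unitInterval.symm_zero, mul_one]
    rfl
  · simp only [unitInterval.symm_one, mul_zero]
end
end

section
/- Let E ⊆ [0,1]² be symmetric and let X ⊆ [0,1] be such that E ⊆ X×X. Suppose there is NO family (O_x)_{x∈X} of subsets of [0,∞), each of the form ⋃_{n∈ℕ}(a_n,b_n) with rationals a_n < b_n and b_n < a_{n+1} for all n, such that for all distinct x, y ∈ X the set O_x ∩ O_y is unbounded in [0,∞) if and only if (x,y) ∈ E. Then C_E is not a continuous image of H*, i.e., there is no continuous surjection from H* onto C_E. -/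
open Set Filter Topology TopologicalSpace

noncomputable section

open scoped NNReal

/-- `ℍ* = βℍ \ ℍ`: the remainder of the Čech–Stone compactification of the
half-line `ℍ = [0,∞)` (realized as `ℝ≥0`). -/
def HStar : Set (StoneCech ℝ≥0) := (Set.range (stoneCechUnit : ℝ≥0 → StoneCech ℝ≥0))ᶜ

namespace Comb

/-- The height function of the tooth over `x`, extended by zero to the whole comb. -/
def toothHeight (x : unitInterval) (p : Comb) : ℝ :=
  open Classical in if p.1 = x then (p.2 : ℝ) else 0

lemma toothHeight_nonneg (x : unitInterval) (p : Comb) : 0 ≤ toothHeight x p := by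
  unfold toothHeight
  split_ifs
  · exact p.2.2.1
  · exact le_rfl

lemma toothHeight_pos_iff {x : unitInterval} {p : Comb} :
    0 < toothHeight x p ↔ p.1 = x ∧ 0 < (p.2 : ℝ) := by
  unfold toothHeight
  split_ifs with h <;> simp [h]

lemma exists_U_abs_toothHeight_sub_lt (x : unitInterval) (p : Comb) {ε : ℝ} (hε : 0 < ε) :
    ∃ n, ∀ q ∈ U p n, |toothHeight x q - toothHeight x p| < ε := by
  have small : ∀ {δ : ℝ}, 0 < δ → ∃ n : ℕ, (2 : ℝ) ^ (-(n : ℤ)) < δ := by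
    intro δ hδ
    obtain ⟨n, hn⟩ := exists_pow_lt_of_lt_one hδ (by norm_num : (1 / 2 : ℝ) < 1)
    refine ⟨n, ?_⟩
    rwa [zpow_neg, zpow_natCast, ← inv_pow, ← one_div]
  by_cases h0 : (p.2 : ℝ) = 0
  · have hp : toothHeight x p = 0 := by simp [toothHeight, h0]
    by_cases hx : p.1 = x
    · obtain ⟨n, hn⟩ := small hε
      refine ⟨n, fun q hq => ?_⟩
      simp only [U, h0, if_true] at hq
      rw [hp, sub_zero, abs_of_nonneg (toothHeight_nonneg x q)]
      unfold toothHeight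
      split_ifs with hqx
      · by_contra! hc
        exact hq.2 ⟨hqx.trans hx.symm, (hn.le.trans hc), q.2.2.2⟩
      · exact hε
    · have hd : 0 < |(x : ℝ) - p.1| := abs_pos.2 (sub_ne_zero.2 fun h => hx (Subtype.ext h).symm)
      obtain ⟨n, hn⟩ := small hd
      refine ⟨n, fun q hq => ?_⟩
      simp only [U, h0, if_true] at hq
      have hqx : q.1 ≠ x := by
        rintro rfl
        have h1 := hq.1.1
        have h2 := hq.1.2
        exact absurd (abs_sub_lt_iff.2 ⟨by linarith, by linarith⟩) hn.le.not_gt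
      rw [hp, toothHeight, if_neg hqx]
      simpa using hε
  · obtain ⟨n, hn⟩ := small hε
    refine ⟨n, fun q hq => ?_⟩
    simp only [U, h0, if_false] at hq
    obtain ⟨h1, h2, h3⟩ := hq
    unfold toothHeight
    rw [h1]
    split_ifs
    · exact abs_sub_lt_iff.2 ⟨by linarith, by linarith⟩
    · simpa using hε

lemma continuous_toothHeight (x : unitInterval) : Continuous (toothHeight x) := by
  refine continuous_def.2 fun s hs p hp => ?_
  obtain ⟨ε, hε, hball⟩ := Metric.isOpen_iff.1 hs _ hp
  obtain ⟨n, hn⟩ := exists_U_abs_toothHeight_sub_lt x p hε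
  refine mem_iInf_of_mem n (mem_principal.2 fun q hq => hball ?_)
  simpa [Real.dist_eq] using hn q hq

/-- The larger of the two heights of a point of `C × C` over the cross through `x`. -/
def crossHeight (x : unitInterval) (p : Comb × Comb) : ℝ :=
  max (toothHeight x p.1) (toothHeight x p.2)

lemma continuous_crossHeight (x : unitInterval) : Continuous (crossHeight x) :=
  ((continuous_toothHeight x).comp continuous_fst).max
    ((continuous_toothHeight x).comp continuous_snd)

lemma mem_CE_of_mem {E : Set (unitInterval × unitInterval)} {p : Comb × Comb}
    (h : (p.1.1, p.2.1) ∈ E) : p ∈ CE E := by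
  simp only [CE, removedSet, mem_compl_iff, mem_iUnion, not_exists]
  rintro ⟨u, v⟩ hq ⟨h1, -, h2, -⟩
  simp only at h1 h2
  exact hq (by rwa [← h1, ← h2])

lemma mem_of_mem_CE {E : Set (unitInterval × unitInterval)} {p : Comb × Comb}
    (hp : p ∈ CE E) (h1 : 0 < (p.1.2 : ℝ)) (h2 : 0 < (p.2.2 : ℝ)) : (p.1.1, p.2.1) ∈ E := by
  by_contra h
  exact hp (mem_biUnion h ⟨rfl, ⟨h1, p.1.2.2.2⟩, rfl, h2, p.2.2.2.2⟩)

lemma baseSquare_subset_CE (E : Set (unitInterval × unitInterval)) : baseSquare ⊆ CE E := by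
  intro p hp
  simp only [CE, removedSet, mem_compl_iff, mem_iUnion, not_exists]
  rintro q - ⟨-, h, -⟩
  exact h.1.ne' hp.1

lemma crossHeight_eq_zero {x : unitInterval} {p : Comb × Comb} (hp : p ∈ baseSquare) :
    crossHeight x p = 0 := by
  simp [crossHeight, toothHeight, hp.1, hp.2]

lemma mem_of_crossHeight_pos {E : Set (unitInterval × unitInterval)} (hE : SymmSet E)
    {x y : unitInterval} (hxy : x ≠ y) {p : Comb × Comb} (hp : p ∈ CE E)
    (hx : 0 < crossHeight x p) (hy : 0 < crossHeight y p) : (x, y) ∈ E := by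
  rw [crossHeight, lt_max_iff, toothHeight_pos_iff, toothHeight_pos_iff] at hx hy
  rcases hx with ⟨hx, hx'⟩ | ⟨hx, hx'⟩ <;> rcases hy with ⟨hy, hy'⟩ | ⟨hy, hy'⟩
  · exact absurd (hx.symm.trans hy) hxy
  · have := mem_of_mem_CE hp hx' hy'
    rwa [hx, hy] at this
  · have := mem_of_mem_CE hp hy' hx'
    rw [hx, hy] at this
    exact (hE _ _).1 this
  · exact absurd (hx.symm.trans hy) hxy

end Comb

section HalfLine

lemma mem_image_stoneCechUnit_of_bddAbove {W : Set (StoneCech ℝ≥0)} (hW : IsOpen W)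
    (hb : BddAbove (stoneCechUnit ⁻¹' W)) {p : StoneCech ℝ≥0} (hp : p ∈ W) :
    p ∈ range (stoneCechUnit : ℝ≥0 → StoneCech ℝ≥0) := by
  obtain ⟨M, hM⟩ := hb
  have hcl : IsClosed (stoneCechUnit '' Icc (0 : ℝ≥0) M) :=
    (isCompact_Icc.image continuous_stoneCechUnit).isClosed
  have h1 : W ⊆ closure (W ∩ range stoneCechUnit) :=
    denseRange_stoneCechUnit.open_subset_closure_inter hW
  have h2 : closure (W ∩ range stoneCechUnit) ⊆ stoneCechUnit '' Icc (0 : ℝ≥0) M := by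
    refine closure_minimal ?_ hcl
    rintro _ ⟨hq, t, rfl⟩
    exact ⟨t, ⟨zero_le, hM hq⟩, rfl⟩
  exact image_subset_range _ _ (h2 (h1 hp))

lemma not_bddAbove_preimage_of_mem_HStar {W : Set (StoneCech ℝ≥0)} (hW : IsOpen W)
    {p : StoneCech ℝ≥0} (hp : p ∈ W) (hH : p ∈ HStar) : ¬ BddAbove (stoneCechUnit ⁻¹' W) :=
  fun hb => hH (mem_image_stoneCechUnit_of_bddAbove hW hb hp)

/-- Truncation at height `t`, extended to the Čech–Stone compactification. -/
lemma exists_extend_min (t : ℝ≥0) :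
    ∃ F : StoneCech ℝ≥0 → ℝ, Continuous F ∧ ∀ s : ℝ≥0, F (stoneCechUnit s) = min (s : ℝ) t := by
  have hc : Continuous fun s : ℝ≥0 =>
      (⟨min (s : ℝ) t, le_min s.2 t.2, min_le_right _ _⟩ : Icc (0 : ℝ) t) := by
    fun_prop
  refine ⟨fun q => (stoneCechExtend hc q : Icc (0 : ℝ) t),
    continuous_subtype_val.comp (continuous_stoneCechExtend hc), fun s => ?_⟩
  exact congrArg Subtype.val (congrFun (stoneCechExtend_extends hc) s)

lemma isClosed_HStar : IsClosed HStar := by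
  refine isOpen_compl_iff.1 ?_
  rw [HStar, compl_compl, isOpen_iff_mem_nhds]
  rintro _ ⟨t, rfl⟩
  obtain ⟨F, hF, hFt⟩ := exists_extend_min (t + 1)
  have hW : IsOpen (F ⁻¹' Iio ((t : ℝ) + 1)) := isOpen_Iio.preimage hF
  refine mem_of_superset (hW.mem_nhds ?_)
    fun p hp => mem_image_stoneCechUnit_of_bddAbove hW ⟨t + 1, fun s hs => ?_⟩ hp
  · simp [hFt]
  · simp only [mem_preimage, hFt, mem_Iio, min_lt_iff, NNReal.coe_add, NNReal.coe_one,
      lt_self_iff_false, or_false] at hs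
    exact_mod_cast hs.le

lemma exists_mem_HStar_mem_closure_image {A : Set ℝ≥0} (hA : ¬ BddAbove A) :
    ∃ p ∈ HStar, p ∈ closure (stoneCechUnit '' A) := by
  have hne : (atTop ⊓ 𝓟 A : Filter ℝ≥0).NeBot := by
    rw [← frequently_mem_iff_neBot, frequently_atTop]
    intro M
    obtain ⟨t, ht, hMt⟩ := not_bddAbove_iff.1 hA M
    exact ⟨t, hMt.le, ht⟩
  let u := Ultrafilter.of (atTop ⊓ 𝓟 A : Filter ℝ≥0)
  have hu : (u : Filter ℝ≥0) ≤ atTop ⊓ 𝓟 A := Ultrafilter.of_le _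
  obtain ⟨p, -, hp⟩ := isCompact_univ.ultrafilter_le_nhds (u.map stoneCechUnit)
    (by simp)
  have hlim : Tendsto stoneCechUnit (u : Filter ℝ≥0) (𝓝 p) := hp
  refine ⟨p, ?_, mem_closure_of_tendsto hlim ?_⟩
  · rintro ⟨t, rfl⟩
    obtain ⟨F, hF, hFt⟩ := exists_extend_min (t + 1)
    have h1 := (hF.tendsto (stoneCechUnit t)).comp hlim
    have h2 : Tendsto (F ∘ stoneCechUnit) (u : Filter ℝ≥0) (𝓝 ((t : ℝ) + 1)) := by
      refine tendsto_const_nhds.congr' ?_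
      filter_upwards [(hu.trans inf_le_left) (eventually_ge_atTop (t + 1))] with s hs
      have hs' : (t : ℝ) + 1 ≤ s := by exact_mod_cast hs
      simp [hFt, hs']
    have h3 := tendsto_nhds_unique h1 h2
    simp [hFt] at h3
  · exact (hu.trans inf_le_right) (mem_principal.2 fun s hs => mem_image_of_mem _ hs)

end HalfLine

section Intervals

lemma exists_rat_interval_between {ψ : ℝ → ℝ} (hψ : Continuous ψ) {α β : ℝ} (hαβ : α < β)
    (hβ : ¬ BddAbove {t | β ≤ ψ t}) (hα : ¬ BddAbove {t | ψ t ≤ α}) {c : ℝ} (hc : ψ c ≤ α) :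
    ∃ (a b : ℚ) (s e : ℝ), c < a ∧ (a : ℝ) < s ∧ s < b ∧ b < e ∧ β ≤ ψ s ∧ ψ e ≤ α ∧
      (∀ t : ℝ, a < t → t < b → α < ψ t) ∧ ∀ t, c ≤ t → t ≤ e → β ≤ ψ t → a < t ∧ t < b := by
  have first : ∀ {P : Set ℝ} (d : ℝ), IsClosed P → ¬ BddAbove P →
      ∃ m ∈ P, d ≤ m ∧ ∀ t ∈ P, d ≤ t → m ≤ t := by
    intro P d hP hb
    obtain ⟨t, ht, hdt⟩ := not_bddAbove_iff.1 hb d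
    have hbelow : BddBelow (P ∩ Ici d) := ⟨d, fun _ h => h.2⟩
    have hm := (hP.inter isClosed_Ici).csInf_mem ⟨t, ht, hdt.le⟩ hbelow
    exact ⟨_, hm.1, hm.2, fun t ht hd => csInf_le hbelow ⟨ht, hd⟩⟩
  obtain ⟨s, hs, hcs, hsmin⟩ := first c (isClosed_le continuous_const hψ) hβ
  obtain ⟨e, he, hse, hemin⟩ := first s (isClosed_le hψ continuous_const) hα
  simp only [mem_ofPred_eq] at hs he hsmin hemin
  have hcs' : c < s := hcs.lt_of_ne (by rintro rfl; linarith)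
  have hse' : s < e := hse.lt_of_ne (by rintro rfl; linarith)
  obtain ⟨l, hl, hls⟩ := exists_Ioc_subset_of_mem_nhds
    ((isOpen_Ioi.preimage hψ).mem_nhds (show α < ψ s by linarith)) ⟨c, hcs'⟩
  obtain ⟨r, hr, hre⟩ := exists_Ioc_subset_of_mem_nhds
    ((isOpen_Iio.preimage hψ).mem_nhds (show ψ e < β by linarith)) ⟨s, hse'⟩
  obtain ⟨a, hla, has⟩ := exists_rat_btwn (max_lt hl hcs')
  obtain ⟨b, hrb, hbe⟩ := exists_rat_btwn (max_lt hr hse')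
  rw [max_lt_iff] at hla hrb
  refine ⟨a, b, s, e, hla.2, has, hrb.2, hbe, hs, he, fun t hat htb => ?_,
    fun t hct hte ht => ⟨has.trans_le (hsmin t ht hct), ?_⟩⟩
  · rcases le_total t s with h | h
    · exact hls ⟨hla.1.trans hat, h⟩
    · by_contra! hc
      linarith [hemin t hc h]
  · by_contra! hbt
    have : ψ t < β := hre ⟨hrb.1.trans_le hbt, hte⟩
    linarith

/-- A closed superlevel set and a larger open one are separated, near infinity, by a union of an
increasing sequence of rational intervals. -/
lemma exists_rat_intervals_between {ψ : ℝ → ℝ} (hψ : Continuous ψ) {α β : ℝ} (hαβ : α < β)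
    (hα : ¬ BddAbove {t | ψ t ≤ α}) :
    ∃ a b : ℕ → ℚ, (∀ n, a n < b n ∧ b n < a (n + 1)) ∧
      (∀ n (t : ℝ), 0 ≤ t → a n < t → t < b n → α < ψ t) ∧
      ∃ M, ∀ t, M ≤ t → β ≤ ψ t → ∃ n, a n < t ∧ t < b n := by
  by_cases hβ : BddAbove {t | β ≤ ψ t}
  · obtain ⟨M, hM⟩ := hβ
    refine ⟨fun n => -(1 / (2 * n + 1)), fun n => -(1 / (2 * n + 2)), fun n => ⟨?_, ?_⟩,
      fun n t ht _ htb => ?_, M + 1, fun t ht htβ => ?_⟩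
    · exact neg_lt_neg (one_div_lt_one_div_of_lt (by positivity) (by linarith))
    · refine neg_lt_neg (one_div_lt_one_div_of_lt (by positivity) ?_)
      push_cast
      linarith
    · have : (0 : ℝ) < 1 / (2 * n + 2) := by positivity
      push_cast at htb
      linarith
    · linarith [hM htβ]
  · choose a b s e hca has hsb hbe hs he hV hK using
      fun c : {c // ψ c ≤ α} => exists_rat_interval_between hψ hαβ hβ hα c.2
    obtain ⟨c₀, hc₀, -⟩ := not_bddAbove_iff.1 hα 0
    let c : ℕ → {c // ψ c ≤ α} := fun n =>
      Nat.rec ⟨c₀, hc₀⟩ (fun _ d => ⟨e d, he d⟩) n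
    have hcs : ∀ n, (c (n + 1) : ℝ) = e (c n) := fun n => rfl
    refine ⟨fun n => a (c n), fun n => b (c n), fun n => ⟨?_, ?_⟩,
      fun n t _ => hV (c n) t, c₀, fun t ht htβ => ?_⟩
    · exact_mod_cast (has (c n)).trans (hsb (c n))
    · have := (hbe (c n)).trans_eq (hcs n).symm |>.trans (hca (c (n + 1)))
      exact_mod_cast this
    · by_contra! hno
      have hle : ∀ n, (c n).1 ≤ t := by
        intro n
        induction n with
        | zero => exact ht
        | succ n ih =>
          by_contra! hlt
          obtain ⟨h1, h2⟩ := hK (c n) t ih hlt.le htβ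
          exact (hno n h1).not_gt h2
      have hcs' : ∀ n, (c n).1 ≤ s (c n) := fun n => ((hca _).trans (has _)).le
      have hsc : ∀ n, s (c n) ≤ (c (n + 1)).1 := fun n => ((hsb _).trans (hbe _)).le
      have hmono : Monotone fun n => (c n).1 :=
        monotone_nat_of_le_succ fun n => (hcs' n).trans (hsc n)
      have hlim := tendsto_atTop_ciSup hmono ⟨t, forall_mem_range.2 hle⟩
      have hlim' : Tendsto (fun n => s (c n)) atTop (𝓝 (⨆ n, (c n).1)) :=
        tendsto_of_tendsto_of_tendsto_of_le_of_le hlim (hlim.comp (tendsto_add_atTop_nat 1))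
          hcs' hsc
      have h1 := le_of_tendsto ((hψ.tendsto _).comp hlim) (Eventually.of_forall fun n => (c n).2)
      have h2 := ge_of_tendsto ((hψ.tendsto _).comp hlim') (Eventually.of_forall fun n => hs (c n))
      linarith

end Intervals

/-- Let `E ⊆ [0,1]²` be symmetric with `E ⊆ X × X`. Suppose there is NO
family `(O_x)_{x ∈ X}` of subsets of `[0,∞)`, each of the form `⋃ n, (a n, b n)` with
rationals `a n < b n` and `b n < a (n+1)`, such that for all distinct `x, y ∈ X` the
set `O_x ∩ O_y` is unbounded in `[0,∞)` iff `(x,y) ∈ E`. Then `C_E` is not a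
continuous image of `ℍ*`. -/
theorem CE_not_HStar_image (E : Set (unitInterval × unitInterval))
    (hE : Comb.SymmSet E) (X : Set unitInterval) (hEX : E ⊆ X ×ˢ X)
    (hrep : ¬ ∃ a b : ↥X → ℕ → ℚ,
      (∀ x n, a x n < b x n ∧ b x n < a x (n + 1)) ∧
      (∀ x y : ↥X, x ≠ y →
        (¬ BddAbove ((⋃ n, {t : ℝ≥0 | (a x n : ℝ) < (t : ℝ) ∧ (t : ℝ) < (b x n : ℝ)}) ∩
            (⋃ n, {t : ℝ≥0 | (a y n : ℝ) < (t : ℝ) ∧ (t : ℝ) < (b y n : ℝ)})) ↔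
          ((x : unitInterval), (y : unitInterval)) ∈ E))) :
    ¬ ∃ g : ↥HStar → ↥(Comb.CE E), Continuous g ∧ Function.Surjective g := by
  rintro ⟨g, hg, hsurj⟩
  refine hrep ?_
  have hext : ∀ x : X, ∃ F : C(StoneCech ℝ≥0, ℝ),
      ∀ p : HStar, F p = Comb.crossHeight x (g p : Comb × Comb) := by
    intro x
    obtain ⟨F, hF⟩ := ContinuousMap.exists_restrict_eq isClosed_HStar
      (⟨fun p => Comb.crossHeight x (g p : Comb × Comb),
        (Comb.continuous_crossHeight x).comp (continuous_subtype_val.comp hg)⟩ : C(HStar, ℝ))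
    exact ⟨F, fun p => DFunLike.congr_fun hF p⟩
  choose F hF using hext
  have hψ : ∀ x, Continuous fun t : ℝ => F x (stoneCechUnit t.toNNReal) := fun x =>
    (F x).continuous.comp (continuous_stoneCechUnit.comp continuous_real_toNNReal)
  have hα : ∀ x, ¬ BddAbove {t : ℝ | F x (stoneCechUnit t.toNNReal) ≤ 1 / 4} := by
    rintro x ⟨M, hM⟩
    have hmem : ((Comb.mk 0 0, Comb.mk 0 0) : Comb × Comb) ∈ Comb.baseSquare := ⟨rfl, rfl⟩
    obtain ⟨p, hp⟩ := hsurj ⟨_, Comb.baseSquare_subset_CE E hmem⟩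
    have hp0 : F x p = 0 := by rw [hF, hp, Comb.crossHeight_eq_zero hmem]
    refine not_bddAbove_preimage_of_mem_HStar (isOpen_Iio.preimage (F x).continuous)
      (show (p : StoneCech ℝ≥0) ∈ F x ⁻¹' Iio (1 / 4) by simp [hp0]) p.2
      ⟨M.toNNReal, fun t ht => ?_⟩
    exact NNReal.le_toNNReal_of_coe_le (hM (by simpa using (show F x _ < 1 / 4 from ht).le))
  choose a b hab hV M hK using fun x =>
    exists_rat_intervals_between (hψ x) (by norm_num : (1 / 4 : ℝ) < 1 / 2) (hα x)
  refine ⟨a, b, hab, fun x y hxy => ⟨fun hunb => ?_, fun hmem hbdd => ?_⟩⟩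
  · obtain ⟨p, hp, hcl⟩ := exists_mem_HStar_mem_closure_image hunb
    have hlow : ∀ z (A : Set ℝ≥0), p ∈ closure (stoneCechUnit '' A) →
        (A ⊆ ⋃ n, {t : ℝ≥0 | (a z n : ℝ) < (t : ℝ) ∧ (t : ℝ) < (b z n : ℝ)}) →
        0 < Comb.crossHeight z (g ⟨p, hp⟩ : Comb × Comb) := by
      intro z A hA hsub
      have : p ∈ {q | 1 / 4 ≤ F z q} := by
        refine closure_minimal ?_ (isClosed_le continuous_const (F z).continuous) hA
        rintro _ ⟨t, ht, rfl⟩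
        obtain ⟨n, h1, h2⟩ := mem_iUnion.1 (hsub ht)
        simpa using (hV z n t t.2 h1 h2).le
      rw [← hF z ⟨p, hp⟩]
      exact lt_of_lt_of_le (by norm_num) this
    exact Comb.mem_of_crossHeight_pos hE (fun h => hxy (Subtype.ext h)) (g ⟨p, hp⟩).2
      (hlow x _ hcl inter_subset_left) (hlow y _ hcl inter_subset_right)
  · obtain ⟨p, hp⟩ := hsurj ⟨(Comb.mk x 1, Comb.mk y 1), Comb.mem_CE_of_mem hmem⟩
    have hx : 1 / 2 < F x p := by
      rw [hF, hp]
      exact lt_max_of_lt_left (by norm_num [Comb.toothHeight, Comb.mk])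
    have hy : 1 / 2 < F y p := by
      rw [hF, hp]
      exact lt_max_of_lt_right (by norm_num [Comb.toothHeight, Comb.mk])
    obtain ⟨N, hN⟩ := hbdd
    refine not_bddAbove_preimage_of_mem_HStar
      ((isOpen_Ioi.preimage (F x).continuous).inter (isOpen_Ioi.preimage (F y).continuous))
      (show (p : StoneCech ℝ≥0) ∈ F x ⁻¹' Ioi (1 / 2) ∩ F y ⁻¹' Ioi (1 / 2) from ⟨hx, hy⟩) p.2
      ⟨N ⊔ ((M x).toNNReal ⊔ (M y).toNNReal), fun t ht => ?_⟩
    by_contra! hlt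
    simp only [sup_lt_iff] at hlt
    refine hlt.1.not_ge (hN ⟨mem_iUnion.2 ?_, mem_iUnion.2 ?_⟩)
    · exact hK x t (Real.toNNReal_le_iff_le_coe.1 hlt.2.1.le)
        (by simpa using (show 1 / 2 < F x _ from ht.1).le)
    · exact hK y t (Real.toNNReal_le_iff_le_coe.1 hlt.2.2.le)
        (by simpa using (show 1 / 2 < F y _ from ht.2).le)
end
end
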